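/- arXiv:1711.08517 — 2 statements merged into one kernel-verified Lean document; each statement's English description precedes it below -/
import Mathlib

section
/- Suppose τ ≤ 0, x_k⁽¹⁾ ≠ 0, and let r ≥ 1 be an integer such that a·2^{r−1} < |x_k⁽¹⁾| < a·2^{r}. Then: (i) every step t with 0 < t ≤ |x_k⁽¹⁾|/a satisfies the Armijo condition A(t) but fails the Wolfe condition W(t); (ii) the step t = 2^{r} satisfies both A(t) and W(t). (In particular, the Armijo–Wolfe bracketing line search started at t = 1, which doubles t while A(t) holds and W(t) fails, returns the step 2^{r}.) -/
/-- The index of the first coordinate of `ℝⁿ` (requires `n ≥ 2`). -/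
def firstIdx {n : ℕ} (hn : 2 ≤ n) : Fin n := ⟨0, by omega⟩

/-- The objective function `f(x) = a|x⁽¹⁾| + ∑_{i=2}^n x⁽ⁱ⁾` on `ℝⁿ`. -/
noncomputable def objF {n : ℕ} (hn : 2 ≤ n) (a : ℝ) (x : EuclideanSpace ℝ (Fin n)) : ℝ :=
  a * |x (firstIdx hn)| + ∑ i ∈ Finset.univ.erase (firstIdx hn), x i

/-- The gradient vector `∇f(x) = (sgn(x⁽¹⁾)·a, 1, …, 1)` of `f` at a point `x`
(meaningful when `x⁽¹⁾ ≠ 0`); here `Real.sign u = 1` if `u > 0` and `-1` if `u < 0`. -/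
noncomputable def gradF {n : ℕ} (hn : 2 ≤ n) (a : ℝ) (x : EuclideanSpace ℝ (Fin n)) :
    EuclideanSpace ℝ (Fin n) :=
  (EuclideanSpace.equiv (Fin n) ℝ).symm
    (fun i => if i = firstIdx hn then Real.sign (x (firstIdx hn)) * a else 1)

/-- The steepest-descent search direction `d = −∇f(x)`. -/
noncomputable def dir {n : ℕ} (hn : 2 ≤ n) (a : ℝ) (x : EuclideanSpace ℝ (Fin n)) :
    EuclideanSpace ℝ (Fin n) := -(gradF hn a x)

/-- The Armijo condition `A(t)`:
`f(x + t·d) ≤ f(x) − c₁·t·(a² + n − 1)` where `d = −∇f(x)`. -/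
def armijo {n : ℕ} (hn : 2 ≤ n) (a c₁ : ℝ) (x : EuclideanSpace ℝ (Fin n)) (t : ℝ) : Prop :=
  objF hn a (x + t • dir hn a x) ≤ objF hn a x - c₁ * t * (a ^ 2 + ((n : ℝ) - 1))

/-- The Wolfe condition `W(t)`: `f` is differentiable at `x + t·d` and
`⟨∇f(x + t·d), d⟩ ≥ −c₂·(a² + n − 1)` where `d = −∇f(x)`. -/
noncomputable def wolfe {n : ℕ} (hn : 2 ≤ n) (a c₂ : ℝ) (x : EuclideanSpace ℝ (Fin n))
    (t : ℝ) : Prop :=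
  DifferentiableAt ℝ (objF hn a) (x + t • dir hn a x) ∧
    (inner ℝ (gradient (objF hn a) (x + t • dir hn a x)) (dir hn a x) : ℝ) ≥
      -c₂ * (a ^ 2 + ((n : ℝ) - 1))

/-- `τ = c₁ + (n − 1)(c₁ − 1)/a²`. -/
noncomputable def tauP (n : ℕ) (a c₁ : ℝ) : ℝ := c₁ + ((n : ℝ) - 1) * (c₁ - 1) / a ^ 2

theorem inner_gradF {n : ℕ} (hn : 2 ≤ n) (a : ℝ) (x y : EuclideanSpace ℝ (Fin n)) :
    (inner ℝ (gradF hn a x) y : ℝ) = Real.sign (x (firstIdx hn)) * a * y (firstIdx hn)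
      + ∑ i ∈ Finset.univ.erase (firstIdx hn), y i := by
  rw [PiLp.inner_apply, ← Finset.add_sum_erase _ _ (Finset.mem_univ (firstIdx hn))]
  congr 1
  · simp [gradF, mul_comm]
  · refine Finset.sum_congr rfl fun i hi => ?_
    have := Finset.ne_of_mem_erase hi
    simp [gradF, this]

theorem abs_eq_sign_mul (u : ℝ) : |u| = Real.sign u * u := by
  rcases lt_trichotomy u 0 with h | h | h
  · rw [Real.sign_of_neg h, abs_of_neg h]; ring
  · simp [h]
  · rw [Real.sign_of_pos h, abs_of_pos h]; ring

theorem hasGradientAt_objF {n : ℕ} (hn : 2 ≤ n) (a : ℝ) (x : EuclideanSpace ℝ (Fin n))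
    (hx : x (firstIdx hn) ≠ 0) : HasGradientAt (objF hn a) (gradF hn a x) x := by
  rw [hasGradientAt_iff_hasFDerivAt]
  refine (ContinuousLinearMap.hasFDerivAt _).congr_of_eventuallyEq ?_
  have hc : Continuous fun y : EuclideanSpace ℝ (Fin n) => y (firstIdx hn) := by fun_prop
  have key : ∀ᶠ y : EuclideanSpace ℝ (Fin n) in nhds x,
      Real.sign (y (firstIdx hn)) = Real.sign (x (firstIdx hn)) := by
    rcases lt_or_gt_of_ne hx with h | h
    · filter_upwards [hc.continuousAt.eventually_lt continuousAt_const h] with y hy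
      rw [Real.sign_of_neg h, Real.sign_of_neg hy]
    · filter_upwards [continuousAt_const.eventually_lt hc.continuousAt h] with y hy
      rw [Real.sign_of_pos h, Real.sign_of_pos hy]
  filter_upwards [key] with y hy
  rw [InnerProductSpace.toDual_apply_apply, inner_gradF, objF, abs_eq_sign_mul, hy]
  ring

theorem not_diff_objF {n : ℕ} (hn : 2 ≤ n) (a : ℝ) (ha : 0 < a) (x : EuclideanSpace ℝ (Fin n))
    (hx : x (firstIdx hn) = 0) : ¬ DifferentiableAt ℝ (objF hn a) x := by
  intro h
  let g : ℝ → EuclideanSpace ℝ (Fin n) :=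
    fun s => x + s • EuclideanSpace.single (firstIdx hn) (1 : ℝ)
  have hg : DifferentiableAt ℝ g 0 := by fun_prop
  have h0 : g 0 = x := by simp [g]
  have h1 : DifferentiableAt ℝ (fun s => objF hn a (g s)) 0 := by
    rw [← h0] at h
    exact DifferentiableAt.comp (0 : ℝ) h hg
  have h2 : (fun s => objF hn a (g s)) =
      fun s => a * |s| + ∑ i ∈ Finset.univ.erase (firstIdx hn), x i := by
    funext s
    unfold objF
    congr 1
    · simp [g, hx]
    · refine Finset.sum_congr rfl fun i hi => ?_
      have := Finset.ne_of_mem_erase hi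
      simp [g, this]
  rw [h2] at h1
  apply not_differentiableAt_abs_zero
  have h3 := (h1.sub_const (∑ i ∈ Finset.univ.erase (firstIdx hn), x i)).const_mul a⁻¹
  refine h3.congr_of_eventuallyEq (Filter.Eventually.of_forall fun s => ?_)
  simp only [add_sub_cancel_right]
  field_simp

theorem step_first {n : ℕ} (hn : 2 ≤ n) (a t : ℝ) (x : EuclideanSpace ℝ (Fin n)) :
    (x + t • dir hn a x) (firstIdx hn)
      = Real.sign (x (firstIdx hn)) * (|x (firstIdx hn)| - t * a) := by
  have h : Real.sign (x (firstIdx hn)) * |x (firstIdx hn)| = x (firstIdx hn) := by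
    rcases lt_trichotomy (x (firstIdx hn)) 0 with h | h | h
    · rw [Real.sign_of_neg h, abs_of_neg h]; ring
    · simp [h]
    · rw [Real.sign_of_pos h, abs_of_pos h]; ring
  rw [mul_sub, h]
  simp [dir, gradF]
  ring

theorem sum_dir {n : ℕ} (hn : 2 ≤ n) (a : ℝ) (x : EuclideanSpace ℝ (Fin n)) :
    ∑ i ∈ Finset.univ.erase (firstIdx hn), (dir hn a x) i = -((n : ℝ) - 1) := by
  have : ∀ i ∈ Finset.univ.erase (firstIdx hn), (dir hn a x) i = -1 := by
    intro i hi
    have := Finset.ne_of_mem_erase hi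
    simp [dir, gradF, this]
  rw [Finset.sum_congr rfl this]
  rw [Finset.sum_const, Finset.card_erase_of_mem (Finset.mem_univ _)]
  simp [Nat.cast_sub (show 1 ≤ n by omega)]

theorem dir_first {n : ℕ} (hn : 2 ≤ n) (a : ℝ) (x : EuclideanSpace ℝ (Fin n)) :
    (dir hn a x) (firstIdx hn) = - (Real.sign (x (firstIdx hn)) * a) := by
  simp [dir, gradF]

theorem objF_step {n : ℕ} (hn : 2 ≤ n) (a t : ℝ) (x : EuclideanSpace ℝ (Fin n))
    (hx : x (firstIdx hn) ≠ 0) :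
    objF hn a (x + t • dir hn a x) = objF hn a x + a * |(|x (firstIdx hn)| - t * a)|
      - a * |x (firstIdx hn)| - t * ((n : ℝ) - 1) := by
  have hs : |Real.sign (x (firstIdx hn))| = 1 := by
    rcases Real.sign_apply_eq_of_ne_zero _ hx with h | h <;> simp [h]
  have h2 : ∑ i ∈ Finset.univ.erase (firstIdx hn), (x + t • dir hn a x) i
      = ∑ i ∈ Finset.univ.erase (firstIdx hn), x i + t * -((n : ℝ) - 1) := by
    rw [← sum_dir hn a x, Finset.mul_sum, ← Finset.sum_add_distrib]
    exact Finset.sum_congr rfl fun i _ => by simp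
  rw [objF, step_first, h2, abs_mul, hs, objF]
  ring

/-- if `τ ≤ 0` and `a·2^(r−1) < |x_k⁽¹⁾| < a·2^r` with `r ≥ 1`, then
(i) every `0 < t ≤ |x_k⁽¹⁾|/a` satisfies `A(t)` but fails `W(t)`;
(ii) `t = 2^r` satisfies both `A(t)` and `W(t)`. -/
theorem stmt11 {n : ℕ} (hn : 2 ≤ n) (a c₁ c₂ : ℝ) (ha : Real.sqrt ((n : ℝ) - 1) ≤ a)
    (hc₁ : 0 < c₁) (hc₁₂ : c₁ < c₂) (hc₂ : c₂ < 1)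
    (hτ : tauP n a c₁ ≤ 0)
    (xk : EuclideanSpace ℝ (Fin n)) (hxk : xk (firstIdx hn) ≠ 0)
    (r : ℕ) (hr : 1 ≤ r)
    (hlb : a * 2 ^ (r - 1) < |xk (firstIdx hn)|) (hub : |xk (firstIdx hn)| < a * 2 ^ r) :
    (∀ t : ℝ, 0 < t → t ≤ |xk (firstIdx hn)| / a →
        armijo hn a c₁ xk t ∧ ¬ wolfe hn a c₂ xk t) ∧
      armijo hn a c₁ xk (2 ^ r) ∧ wolfe hn a c₂ xk (2 ^ r) := by
  set u := |xk (firstIdx hn)| with hu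
  set N : ℝ := (n : ℝ) - 1 with hN
  have hN1 : 1 ≤ N := by
    have : (2 : ℝ) ≤ n := by exact_mod_cast hn
    linarith
  have ha0 : 0 < a := lt_of_lt_of_le (Real.sqrt_pos.2 (by linarith)) ha
  have haN : N ≤ a ^ 2 := (Real.sqrt_le_left ha0.le).1 ha
  have hu0 : 0 < u := abs_pos.2 hxk
  have hτ' : c₁ * (a ^ 2 + N) ≤ N := by
    have h : c₁ + N * (c₁ - 1) / a ^ 2 ≤ 0 := hτ
    have h2 : (c₁ + N * (c₁ - 1) / a ^ 2) * a ^ 2 = c₁ * a ^ 2 + N * (c₁ - 1) := by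
      field_simp
    have h3 := mul_nonpos_of_nonpos_of_nonneg h (sq_nonneg a)
    linarith
  have hss : Real.sign (xk (firstIdx hn)) * Real.sign (xk (firstIdx hn)) = 1 := by
    rcases Real.sign_apply_eq_of_ne_zero _ hxk with h | h <;> simp [h]
  have hs0 : Real.sign (xk (firstIdx hn)) ≠ 0 := fun h => by simp [h] at hss
  have hP : 0 < a ^ 2 + N := by positivity
  have hinner : ∀ t : ℝ, u - t * a ≠ 0 →
      (inner ℝ (gradient (objF hn a) (xk + t • dir hn a xk)) (dir hn a xk) : ℝ)
        = - (Real.sign (Real.sign (xk (firstIdx hn)) * (u - t * a))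
            * Real.sign (xk (firstIdx hn)) * a ^ 2) - N := by
    intro t ht
    have hne : (xk + t • dir hn a xk) (firstIdx hn) ≠ 0 := by
      rw [step_first]; exact mul_ne_zero hs0 ht
    rw [(hasGradientAt_objF hn a _ hne).gradient, inner_gradF, sum_dir, dir_first, step_first]
    ring
  refine ⟨fun t ht htu => ⟨?_, ?_⟩, ?_, ?_, ?_⟩
  · have h1 : t * a ≤ u := (le_div_iff₀ ha0).1 htu
    rw [armijo, objF_step hn a t xk hxk, ← hu, ← hN, abs_of_nonneg (by linarith)]
    have : 0 ≤ (1 - c₁) * (t * (a ^ 2 + N)) :=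
      mul_nonneg (by linarith) (by positivity)
    linarith
  · rintro ⟨hd, hw⟩
    have h1 : t * a ≤ u := (le_div_iff₀ ha0).1 htu
    rcases h1.eq_or_lt with h1 | h1
    · refine not_diff_objF hn a ha0 _ ?_ hd
      rw [step_first, ← hu, h1]; simp
    · rw [hinner t (by linarith)] at hw
      have h2 : Real.sign (Real.sign (xk (firstIdx hn)) * (u - t * a))
          * Real.sign (xk (firstIdx hn)) = 1 := by
        rcases Real.sign_apply_eq_of_ne_zero _ hxk with h | h
        · rw [h, Real.sign_of_neg (by linarith)]; norm_num
        · rw [h, Real.sign_of_pos (by linarith)]; norm_num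
      rw [h2] at hw
      nlinarith
  · have h2 : (2 : ℝ) ^ r = 2 * 2 ^ (r - 1) := by
      rw [← pow_succ']; congr 1; omega
    have h3 : (2 : ℝ) ^ r * a < 2 * u := by rw [h2]; linarith
    have ht : (0 : ℝ) < 2 ^ r := by positivity
    rw [armijo, objF_step hn a _ xk hxk, ← hu, ← hN, abs_of_neg (by linarith)]
    have h4 := mul_le_mul_of_nonneg_left hτ' ht.le
    have h5 := mul_lt_mul_of_pos_left h3 ha0
    linarith
  · refine (hasGradientAt_objF hn a _ ?_).differentiableAt
    rw [step_first]
    exact mul_ne_zero hs0 (by rw [← hu]; linarith)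
  · rw [hinner _ (by linarith)]
    have h2 : Real.sign (Real.sign (xk (firstIdx hn)) * (u - 2 ^ r * a))
        * Real.sign (xk (firstIdx hn)) = -1 := by
      rcases Real.sign_apply_eq_of_ne_zero _ hxk with h | h
      · rw [h, Real.sign_of_pos (by linarith)]; norm_num
      · rw [h, Real.sign_of_neg (by linarith)]; norm_num
    rw [h2]
    have : 0 ≤ c₂ * (a ^ 2 + N) := mul_nonneg (by linarith) hP.le
    linarith
end

section
/- Suppose τ ≤ 0, x_k⁽¹⁾ ≠ 0 and |x_k⁽¹⁾| < a. Then: (i) if |x_k⁽¹⁾| > (1 + τ)·a/2, the step t = 1 satisfies both the Armijo condition A(t) and the Wolfe condition W(t); (ii) if q ≥ 2 is an integer with (1 + τ)·a/2^{q} < |x_k⁽¹⁾| < (1 + τ)·a/2^{q−1}, then the step t = 2^{1−q} satisfies both A(t) and W(t), while the step t = 2^{2−q} fails A(t). -/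
theorem aux_inner {n : ℕ} (hn : 2 ≤ n) (a : ℝ) (y v : EuclideanSpace ℝ (Fin n)) :
    (inner ℝ (gradF hn a y) v : ℝ) = Real.sign (y (firstIdx hn)) * a * v (firstIdx hn)
      + ∑ i ∈ Finset.univ.erase (firstIdx hn), v i := by
  rw [PiLp.inner_apply, ← Finset.add_sum_erase _ _ (Finset.mem_univ (firstIdx hn))]
  congr 1
  · simp [gradF]
    ring
  · apply Finset.sum_congr rfl
    intro i hi
    have := Finset.ne_of_mem_erase hi
    simp [gradF, this]

theorem aux_sign_mul (r : ℝ) : Real.sign r * r = |r| := by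
  rcases lt_trichotomy r 0 with h | h | h
  · rw [Real.sign_of_neg h, abs_of_neg h]; ring
  · simp [h]
  · rw [Real.sign_of_pos h, abs_of_pos h]; ring

theorem aux_grad {n : ℕ} (hn : 2 ≤ n) (a : ℝ) (y : EuclideanSpace ℝ (Fin n))
    (hy : y (firstIdx hn) ≠ 0) : HasGradientAt (objF hn a) (gradF hn a y) y := by
  have h1 : HasFDerivAt (fun z : EuclideanSpace ℝ (Fin n) => (inner ℝ (gradF hn a y) z : ℝ))
      ((InnerProductSpace.toDual ℝ (EuclideanSpace ℝ (Fin n))) (gradF hn a y)) y :=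
    ((InnerProductSpace.toDual ℝ (EuclideanSpace ℝ (Fin n))) (gradF hn a y)).hasFDerivAt
  rw [hasGradientAt_iff_hasFDerivAt]
  refine h1.congr_of_eventuallyEq ?_
  have hc : Continuous (fun z : EuclideanSpace ℝ (Fin n) => z (firstIdx hn)) := by fun_prop
  have hev : ∀ᶠ z in nhds y, Real.sign (z (firstIdx hn)) = Real.sign (y (firstIdx hn)) := by
    rcases lt_or_gt_of_ne hy with h | h
    · filter_upwards [hc.continuousAt.eventually_lt continuousAt_const h] with z hz
      rw [Real.sign_of_neg h, Real.sign_of_neg hz]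
    · filter_upwards [continuousAt_const.eventually_lt hc.continuousAt h] with z hz
      rw [Real.sign_of_pos h, Real.sign_of_pos hz]
  filter_upwards [hev] with z hz
  rw [aux_inner, ← hz, objF, ← aux_sign_mul]
  ring

theorem aux_dir_first {n : ℕ} (hn : 2 ≤ n) (a : ℝ) (x : EuclideanSpace ℝ (Fin n)) :
    dir hn a x (firstIdx hn) = -(Real.sign (x (firstIdx hn)) * a) := by
  simp [dir, gradF]

theorem aux_dir_sum {n : ℕ} (hn : 2 ≤ n) (a : ℝ) (x : EuclideanSpace ℝ (Fin n)) :
    ∑ i ∈ Finset.univ.erase (firstIdx hn), dir hn a x i = -((n : ℝ) - 1) := by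
  have : ∀ i ∈ Finset.univ.erase (firstIdx hn), dir hn a x i = -1 := by
    intro i hi
    have := Finset.ne_of_mem_erase hi
    simp [dir, gradF, this]
  rw [Finset.sum_congr rfl this, Finset.sum_const, Finset.card_erase_of_mem (Finset.mem_univ _)]
  rw [Finset.card_univ, Fintype.card_fin, nsmul_eq_mul, Nat.cast_sub (by omega)]
  push_cast
  ring

theorem aux_step {n : ℕ} (hn : 2 ≤ n) (a t : ℝ) (x : EuclideanSpace ℝ (Fin n))
    (hx : x (firstIdx hn) ≠ 0) (ht : |x (firstIdx hn)| < t * a) :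
    |(x + t • dir hn a x) (firstIdx hn)| = t * a - |x (firstIdx hn)| ∧
    (x + t • dir hn a x) (firstIdx hn) ≠ 0 ∧
    Real.sign ((x + t • dir hn a x) (firstIdx hn)) * Real.sign (x (firstIdx hn)) = -1 := by
  have e : (x + t • dir hn a x) (firstIdx hn)
      = x (firstIdx hn) - t * (Real.sign (x (firstIdx hn)) * a) := by
    rw [PiLp.add_apply, PiLp.smul_apply, aux_dir_first, smul_eq_mul]; ring
  rw [e]
  rcases lt_or_gt_of_ne hx with h | h
  · rw [abs_of_neg h] at ht ⊢
    rw [Real.sign_of_neg h]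
    have : 0 < x (firstIdx hn) - t * (-1 * a) := by linarith
    rw [abs_of_pos this, Real.sign_of_pos this]
    exact ⟨by ring, this.ne', by norm_num⟩
  · rw [abs_of_pos h] at ht ⊢
    rw [Real.sign_of_pos h]
    have : x (firstIdx hn) - t * (1 * a) < 0 := by linarith
    rw [abs_of_neg this, Real.sign_of_neg this]
    exact ⟨by ring, this.ne, by norm_num⟩

theorem aux_armijo {n : ℕ} (hn : 2 ≤ n) (a c₁ t : ℝ) (ha : 0 < a)
    (x : EuclideanSpace ℝ (Fin n))
    (hx : x (firstIdx hn) ≠ 0) (ht : |x (firstIdx hn)| < t * a) :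
    armijo hn a c₁ x t ↔ t * ((1 + tauP n a c₁) * a) ≤ 2 * |x (firstIdx hn)| := by
  have hs : ∑ i ∈ Finset.univ.erase (firstIdx hn), (x + t • dir hn a x) i
      = ∑ i ∈ Finset.univ.erase (firstIdx hn), x i - t * ((n : ℝ) - 1) := by
    simp only [PiLp.add_apply, PiLp.smul_apply, smul_eq_mul]
    rw [Finset.sum_add_distrib, ← Finset.mul_sum, aux_dir_sum]
    ring
  have hτ : a ^ 2 * tauP n a c₁ = c₁ * a ^ 2 + ((n : ℝ) - 1) * (c₁ - 1) := by
    rw [tauP]; field_simp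
  rw [armijo, objF, objF, (aux_step hn a t x hx ht).1, hs,
    ← mul_le_mul_iff_right₀ (b := t * ((1 + tauP n a c₁) * a)) ha]
  have e : a * (t * ((1 + tauP n a c₁) * a))
      = t * (a ^ 2 + (c₁ * a ^ 2 + ((n : ℝ) - 1) * (c₁ - 1))) := by
    rw [← hτ]; ring
  rw [e]
  constructor <;> intro h <;> linarith

theorem aux_wolfe {n : ℕ} (hn : 2 ≤ n) (a c₂ t : ℝ) (ha : Real.sqrt ((n : ℝ) - 1) ≤ a)
    (hc₂ : 0 < c₂) (x : EuclideanSpace ℝ (Fin n))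
    (hx : x (firstIdx hn) ≠ 0) (ht : |x (firstIdx hn)| < t * a) : wolfe hn a c₂ x t := by
  obtain ⟨-, h2, h3⟩ := aux_step hn a t x hx ht
  have hg := aux_grad hn a _ h2
  refine ⟨hg.differentiableAt, ?_⟩
  rw [hg.gradient, aux_inner, aux_dir_first, aux_dir_sum]
  have hn' : (2 : ℝ) ≤ n := by exact_mod_cast hn
  have hsq : (n : ℝ) - 1 ≤ a ^ 2 := (Real.sqrt_le_left (le_trans (Real.sqrt_nonneg _) ha)).1 ha
  have e : ∀ s r : ℝ, s * r = -1 → s * a * -(r * a) = a ^ 2 := by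
    intro s r h
    linear_combination (-a ^ 2) * h
  rw [e _ _ h3]
  have : 0 ≤ c₂ * (a ^ 2 + ((n : ℝ) - 1)) := mul_nonneg hc₂.le (by nlinarith)
  linarith

/-- suppose `τ ≤ 0` and `|x_k⁽¹⁾| < a`. Then
(i) if `|x_k⁽¹⁾| > (1 + τ)·a/2`, the step `t = 1` satisfies `A(t)` and `W(t)`;
(ii) if `(1 + τ)·a/2^q < |x_k⁽¹⁾| < (1 + τ)·a/2^(q−1)` with `q ≥ 2`, the step `t = 2^(1−q)`
satisfies `A(t)` and `W(t)`, while `t = 2^(2−q)` fails `A(t)`. -/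
theorem stmt14 {n : ℕ} (hn : 2 ≤ n) (a c₁ c₂ : ℝ) (ha : Real.sqrt ((n : ℝ) - 1) ≤ a)
    (hc₁ : 0 < c₁) (hc₁₂ : c₁ < c₂) (hc₂ : c₂ < 1)
    (hτ : tauP n a c₁ ≤ 0)
    (xk : EuclideanSpace ℝ (Fin n)) (hxk : xk (firstIdx hn) ≠ 0)
    (hxa : |xk (firstIdx hn)| < a) :
    ((1 + tauP n a c₁) * a / 2 < |xk (firstIdx hn)| →
        armijo hn a c₁ xk 1 ∧ wolfe hn a c₂ xk 1) ∧
      (∀ q : ℕ, 2 ≤ q →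
        (1 + tauP n a c₁) * a / 2 ^ q < |xk (firstIdx hn)| →
        |xk (firstIdx hn)| < (1 + tauP n a c₁) * a / 2 ^ (q - 1) →
        armijo hn a c₁ xk (2 ^ (1 - (q : ℤ))) ∧ wolfe hn a c₂ xk (2 ^ (1 - (q : ℤ))) ∧
          ¬ armijo hn a c₁ xk (2 ^ (2 - (q : ℤ)))) := by
  have ha0 : 0 < a := lt_of_le_of_lt (abs_nonneg _) hxa
  have hc20 : 0 < c₂ := hc₁.trans hc₁₂
  constructor
  · intro h
    have ht : |xk (firstIdx hn)| < 1 * a := by linarith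
    exact ⟨(aux_armijo hn a c₁ 1 ha0 xk hxk ht).2 (by linarith),
      aux_wolfe hn a c₂ 1 ha hc20 xk hxk ht⟩
  · intro q hq h1 h2
    obtain ⟨p, rfl⟩ : ∃ p, q = p + 1 := ⟨q - 1, by omega⟩
    have e1 : (2 : ℝ) ^ (1 - ((p + 1 : ℕ) : ℤ)) = ((2 : ℝ) ^ p)⁻¹ := by
      rw [← zpow_natCast, ← zpow_neg]; congr 1; push_cast; ring
    have e2 : (2 : ℝ) ^ (2 - ((p + 1 : ℕ) : ℤ)) = 2 * ((2 : ℝ) ^ p)⁻¹ := by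
      rw [← zpow_natCast, ← zpow_neg, ← zpow_one_add₀ two_ne_zero]; congr 1; push_cast; ring
    have hpos : 0 < ((2 : ℝ) ^ p)⁻¹ := by positivity
    rw [Nat.add_sub_cancel, div_eq_mul_inv] at h2
    rw [pow_succ, div_eq_mul_inv, mul_inv] at h1
    rw [e1, e2]
    generalize ((2 : ℝ) ^ p)⁻¹ = t at *
    have hta : 0 < t * a := mul_pos hpos ha0
    have ht : |xk (firstIdx hn)| < t * a := by
      nlinarith [mul_nonneg hta.le (neg_nonneg.2 hτ)]
    have ht2 : |xk (firstIdx hn)| < (2 * t) * a := by linarith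
    refine ⟨(aux_armijo hn a c₁ t ha0 xk hxk ht).2 (by linarith),
      aux_wolfe hn a c₂ t ha hc20 xk hxk ht, ?_⟩
    rw [aux_armijo hn a c₁ _ ha0 xk hxk ht2]
    intro h
    linarith
end
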